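/- Let u_1 := 1_2 ⊗ σ_1 and u_2 := 1_2 ⊗ σ_2 in M_4, where σ_1, σ_2 are the Pauli matrices (so that u_1 + i·u_2 = 1_2 ⊗ [[0,2],[0,0]] and W(u_1,u_2) is the closed unit disk, on whose boundary every point is a multiply generated round boundary point). Then the expected value map 𝔼|_{𝓜_4} : 𝓜_4 → W(u_1,u_2) is open (open at every state of 𝓜_4). -/

import Mathlib

open Set Filter Topology Matrix
open scoped ComplexOrder

/-- The joint numerical range `W(u₁,u₂) ⊆ ℝ²` of two (hermitian) matrices. -/
def jointNR {d : ℕ} (u₁ u₂ : Matrix (Fin d) (Fin d) ℂ) : Set (ℝ × ℝ) :=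
  {p | ∃ x : Fin d → ℂ, star x ⬝ᵥ x = 1 ∧
    p = ((star x ⬝ᵥ u₁.mulVec x).re, (star x ⬝ᵥ u₂.mulVec x).re)}

/-- The state space `𝓜_d`: positive semidefinite matrices of trace one. -/
def stateSpace (d : ℕ) : Set (Matrix (Fin d) (Fin d) ℂ) :=
  {ρ | ρ.PosSemidef ∧ ρ.trace = 1}

/-- The expected value map `ρ ↦ (tr(u₁ρ), tr(u₂ρ))` (real for hermitian arguments). -/
noncomputable def expVal2 {d : ℕ} (u₁ u₂ : Matrix (Fin d) (Fin d) ℂ)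
    (ρ : Matrix (Fin d) (Fin d) ℂ) : ℝ × ℝ :=
  ((u₁ * ρ).trace.re, (u₂ * ρ).trace.re)

/-- `f` restricted to `K` (viewed as a map onto `L`, both with subspace topologies) is open at
`v ∈ K` if the image of every neighborhood of `v` in `K` is a neighborhood of `f v` in `L`. -/
def MapsOpenAt {X Y : Type*} [TopologicalSpace X] [TopologicalSpace Y]
    (f : X → Y) (K : Set X) (L : Set Y) (v : X) : Prop :=
  ∀ N : Set X, N ⊆ K → N ∈ nhdsWithin v K → f '' N ∈ nhdsWithin (f v) L

/-- A supporting line of `C` at `p`: the level set of a nonzero linear functional attaining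
its maximum over `C` at `p`. -/
def IsSupportingLineAt (C : Set (ℝ × ℝ)) (p : ℝ × ℝ) (l : Set (ℝ × ℝ)) : Prop :=
  ∃ (φ : (ℝ × ℝ) →ₗ[ℝ] ℝ) (c : ℝ), φ ≠ 0 ∧ l = {q | φ q = c} ∧ φ p = c ∧ ∀ q ∈ C, φ q ≤ c

/-- A corner point of `C`: a point of `C` lying on more than one supporting line. -/
def IsCornerPoint (C : Set (ℝ × ℝ)) (p : ℝ × ℝ) : Prop :=
  p ∈ C ∧ ∃ l₁ l₂ : Set (ℝ × ℝ), l₁ ≠ l₂ ∧ IsSupportingLineAt C p l₁ ∧ IsSupportingLineAt C p l₂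

/-- A round boundary point of `C`: a boundary point which is neither a corner point nor lies
in the relative interior of a flat boundary portion (a nondegenerate segment in the boundary). -/
def IsRoundBoundaryPoint (C : Set (ℝ × ℝ)) (p : ℝ × ℝ) : Prop :=
  p ∈ frontier C ∧ ¬ IsCornerPoint C p ∧
    ¬ ∃ a b : ℝ × ℝ, a ≠ b ∧ segment ℝ a b ⊆ frontier C ∧ p ∈ openSegment ℝ a b

/-- `z` is singularly generated if all unit vectors generating it are proportional. -/
def SinglyGenerated {d : ℕ} (u₁ u₂ : Matrix (Fin d) (Fin d) ℂ) (z : ℝ × ℝ) : Prop :=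
  ∀ x y : Fin d → ℂ, star x ⬝ᵥ x = 1 → star y ⬝ᵥ y = 1 →
    ((star x ⬝ᵥ u₁.mulVec x).re, (star x ⬝ᵥ u₂.mulVec x).re) = z →
    ((star y ⬝ᵥ u₁.mulVec y).re, (star y ⬝ᵥ u₂.mulVec y).re) = z →
    ∃ c : ℂ, y = c • x

/-- `z` is multiply generated if it lies in the joint numerical range but is not
singularly generated. -/
def MultiplyGenerated {d : ℕ} (u₁ u₂ : Matrix (Fin d) (Fin d) ℂ) (z : ℝ × ℝ) : Prop :=
  z ∈ jointNR u₁ u₂ ∧ ¬ SinglyGenerated u₁ u₂ z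

/-- A matrix is unitarily reducible if it is unitarily equivalent to a block diagonal matrix
with (at least) two proper diagonal blocks. -/
def UnitarilyReducible {d : ℕ} (A : Matrix (Fin d) (Fin d) ℂ) : Prop :=
  ∃ (a b : ℕ) (hab : a + b = d), 0 < a ∧ 0 < b ∧
    ∃ U ∈ Matrix.unitaryGroup (Fin d) ℂ,
      ∃ (B : Matrix (Fin a) (Fin a) ℂ) (C : Matrix (Fin b) (Fin b) ℂ),
        star U * A * U =
          Matrix.reindex (finSumFinEquiv.trans (finCongr hab))
            (finSumFinEquiv.trans (finCongr hab)) (Matrix.fromBlocks B 0 0 C)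

/-- A simplex is the convex hull of finitely many affinely independent points. -/
def IsSimplex {Y : Type*} [AddCommGroup Y] [Module ℝ Y] (S : Set Y) : Prop :=
  ∃ s : Finset Y, AffineIndependent ℝ (fun p : (s : Set Y) => (p : Y)) ∧
    S = convexHull ℝ (s : Set Y)

/-- `w` is a simplicial point of `C` if finitely many simplices contained in `C`
cover a neighborhood of `w` in `C`. -/
def IsSimplicialPoint {Y : Type*} [AddCommGroup Y] [Module ℝ Y] [TopologicalSpace Y]
    (C : Set Y) (w : Y) : Prop :=
  ∃ (m : ℕ) (S : Fin m → Set Y),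
    (∀ i, IsSimplex (S i) ∧ S i ⊆ C) ∧ (⋃ i, S i) ∈ nhdsWithin w C

/-- A face of a convex set `C`: a convex subset `F ⊆ C` such that any segment of `C` whose
relative interior meets `F` lies in `F` (i.e. `F` is convex and extreme in `C`). -/
def IsFaceOf {Y : Type*} [AddCommGroup Y] [Module ℝ Y] (C F : Set Y) : Prop :=
  Convex ℝ F ∧ IsExtreme ℝ C F

/-- The dimension of a convex set: the dimension of its affine hull. -/
noncomputable def convDim {Y : Type*} [NormedAddCommGroup Y] [NormedSpace ℝ Y]
    (C : Set Y) : ℕ :=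
  Module.finrank ℝ (affineSpan ℝ C).direction

open Kronecker in
/-- `1₂ ⊗ σ₁` as a `4 × 4` matrix. -/
noncomputable def uOne : Matrix (Fin 4) (Fin 4) ℂ :=
  Matrix.reindex finProdFinEquiv finProdFinEquiv
    ((1 : Matrix (Fin 2) (Fin 2) ℂ) ⊗ₖ !![0, 1; 1, 0])

open Kronecker in
/-- `1₂ ⊗ σ₂` as a `4 × 4` matrix. -/
noncomputable def uTwo : Matrix (Fin 4) (Fin 4) ℂ :=
  Matrix.reindex finProdFinEquiv finProdFinEquiv
    ((1 : Matrix (Fin 2) (Fin 2) ℂ) ⊗ₖ !![0, -Complex.I; Complex.I, 0])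

theorem uOne_eq : uOne = !![0, 1, 0, 0; 1, 0, 0, 0; 0, 0, 0, 1; 0, 0, 1, 0] := by
  ext i j
  fin_cases i <;> fin_cases j <;>
    simp [uOne, finProdFinEquiv, Fin.divNat, Fin.modNat]

theorem uTwo_eq : uTwo =
    !![0, -Complex.I, 0, 0; Complex.I, 0, 0, 0; 0, 0, 0, -Complex.I; 0, 0, Complex.I, 0] := by
  ext i j
  fin_cases i <;> fin_cases j <;>
    simp [uTwo, finProdFinEquiv, Fin.divNat, Fin.modNat]

theorem quadForm_uOne (x : Fin 4 → ℂ) : (star x ⬝ᵥ uOne.mulVec x).re =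
    2 * ((x 0).re * (x 1).re + (x 0).im * (x 1).im + (x 2).re * (x 3).re
      + (x 2).im * (x 3).im) := by
  simp [uOne_eq, dotProduct, Matrix.mulVec, Fin.sum_univ_four]
  ring

theorem quadForm_uTwo (x : Fin 4 → ℂ) : (star x ⬝ᵥ uTwo.mulVec x).re =
    2 * ((x 0).re * (x 1).im - (x 0).im * (x 1).re + (x 2).re * (x 3).im
      - (x 2).im * (x 3).re) := by
  simp [uTwo_eq, dotProduct, Matrix.mulVec, Fin.sum_univ_four]
  ring

theorem star_dotProduct_self_eq_one_iff (x : Fin 4 → ℂ) : star x ⬝ᵥ x = 1 ↔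
    (x 0).re ^ 2 + (x 0).im ^ 2 + (x 1).re ^ 2 + (x 1).im ^ 2 + (x 2).re ^ 2 + (x 2).im ^ 2
      + (x 3).re ^ 2 + (x 3).im ^ 2 = 1 := by
  simp [Complex.ext_iff, dotProduct, Fin.sum_univ_four]
  constructor
  · rintro ⟨h, -⟩
    linarith
  · intro h
    constructor <;> linarith

theorem expVal2_uOne_uTwo (ρ : Matrix (Fin 4) (Fin 4) ℂ) : expVal2 uOne uTwo ρ =
    ((ρ 1 0).re + (ρ 0 1).re + (ρ 3 2).re + (ρ 2 3).re,
      (ρ 1 0).im - (ρ 0 1).im + (ρ 3 2).im - (ρ 2 3).im) := by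
  simp [expVal2, uOne_eq, uTwo_eq, Matrix.trace, Matrix.vecMul, dotProduct, Fin.sum_univ_four]
  ring

/-- `|2 (star u * v + star w * z)| ≤ 1` for a unit vector `(u, v, w, z)` of `ℂ⁴`, in real
coordinates. -/
theorem sq_add_sq_le_of_unit (a b c d e f g h : ℝ)
    (hn : a ^ 2 + b ^ 2 + c ^ 2 + d ^ 2 + e ^ 2 + f ^ 2 + g ^ 2 + h ^ 2 = 1) :
    (2 * (a * c + b * d + e * g + f * h)) ^ 2 + (2 * (a * d - b * c + e * h - f * g)) ^ 2
      ≤ 1 := by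
  set X := a ^ 2 + b ^ 2 + e ^ 2 + f ^ 2 with hX
  set Y := c ^ 2 + d ^ 2 + g ^ 2 + h ^ 2 with hY
  have key : (a * c + b * d + e * g + f * h) ^ 2 + (a * d - b * c + e * h - f * g) ^ 2
      ≤ X * Y := by
    nlinarith [sq_nonneg (a * g - b * h - e * c + f * d), sq_nonneg (a * h + b * g - e * d - f * c)]
  nlinarith [sq_nonneg (X - Y), show X + Y = 1 by linarith]

theorem jointNR_uOne_uTwo : jointNR uOne uTwo = {p : ℝ × ℝ | p.1 ^ 2 + p.2 ^ 2 ≤ 1} := by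
  ext p
  simp only [jointNR, mem_ofPred_eq, quadForm_uOne, quadForm_uTwo, star_dotProduct_self_eq_one_iff]
  constructor
  · rintro ⟨x, hx, rfl⟩
    exact sq_add_sq_le_of_unit _ _ _ _ _ _ _ _ hx
  · intro hp
    have h2 : √2 ^ 2 = 2 := Real.sq_sqrt (by norm_num)
    have hc := Real.sq_sqrt (sub_nonneg.mpr hp)
    set c := √(1 - (p.1 ^ 2 + p.2 ^ 2))
    refine ⟨![⟨(√2)⁻¹, 0⟩, ⟨(√2)⁻¹ * p.1, (√2)⁻¹ * p.2⟩, ⟨(√2)⁻¹ * c, 0⟩, 0], ?_, ?_⟩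
    · simp [mul_pow, inv_pow, h2]
      linarith
    · have : (√2)⁻¹ * (√2)⁻¹ = 2⁻¹ := by rw [← mul_inv, ← sq, h2]
      ext <;> simp [← mul_assoc, this]

theorem multiplyGenerated_of_mem_circle {p : ℝ × ℝ} (hp : p.1 ^ 2 + p.2 ^ 2 = 1) :
    MultiplyGenerated uOne uTwo p := by
  refine ⟨by simp [jointNR_uOne_uTwo, hp], fun h => ?_⟩
  have h2 : √2 ^ 2 = 2 := Real.sq_sqrt (by norm_num)
  have h3 : (√2)⁻¹ * (√2)⁻¹ = 2⁻¹ := by rw [← mul_inv, ← sq, h2]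
  simp only [SinglyGenerated, quadForm_uOne, quadForm_uTwo, star_dotProduct_self_eq_one_iff] at h
  obtain ⟨c, hc⟩ := h
    ![⟨(√2)⁻¹, 0⟩, ⟨(√2)⁻¹ * p.1, (√2)⁻¹ * p.2⟩, 0, 0]
    ![0, 0, ⟨(√2)⁻¹, 0⟩, ⟨(√2)⁻¹ * p.1, (√2)⁻¹ * p.2⟩]
    (by simp [mul_pow, inv_pow, h2]; linarith) (by simp [mul_pow, inv_pow, h2]; linarith)
    (by ext <;> simp [← mul_assoc, h3]) (by ext <;> simp [← mul_assoc, h3])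
  have := congrFun hc 2
  simp [Complex.ext_iff] at this

theorem isClosed_unitDisk : IsClosed {p : ℝ × ℝ | p.1 ^ 2 + p.2 ^ 2 ≤ 1} :=
  isClosed_le (by fun_prop) (by fun_prop)

theorem mem_frontier_unitDisk {p : ℝ × ℝ} (hp : p.1 ^ 2 + p.2 ^ 2 = 1) :
    p ∈ frontier {p : ℝ × ℝ | p.1 ^ 2 + p.2 ^ 2 ≤ 1} := by
  rw [isClosed_unitDisk.frontier_eq]
  refine ⟨hp.le, fun h => ?_⟩
  have hc : Tendsto (fun t : ℝ => t • p) (𝓝[>] 1) (𝓝 p) := by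
    have : Continuous fun t : ℝ => t • p := by fun_prop
    simpa using (this.tendsto 1).mono_left nhdsWithin_le_nhds
  obtain ⟨t, ht, ht1⟩ :=
    ((hc.eventually (mem_interior_iff_mem_nhds.mp h)).and self_mem_nhdsWithin).exists
  have ht' : (t * p.1) ^ 2 + (t * p.2) ^ 2 ≤ 1 := ht
  have ht1' : 1 < t := ht1
  have : (t * p.1) ^ 2 + (t * p.2) ^ 2 = t ^ 2 := by linear_combination t ^ 2 * hp
  nlinarith

theorem supportingLine_unitDisk {p : ℝ × ℝ} (hp : p.1 ^ 2 + p.2 ^ 2 = 1) {l : Set (ℝ × ℝ)}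
    (hl : IsSupportingLineAt {p : ℝ × ℝ | p.1 ^ 2 + p.2 ^ 2 ≤ 1} p l) :
    l = {q | q.1 * p.1 + q.2 * p.2 = 1} := by
  obtain ⟨φ, c, hφ, rfl, hpc, hmax⟩ := hl
  have hφ' (q : ℝ × ℝ) : φ q = q.1 * φ (1, 0) + q.2 * φ (0, 1) := by
    conv_lhs => rw [show q = q.1 • ((1, 0) : ℝ × ℝ) + q.2 • ((0, 1) : ℝ × ℝ) by ext <;> simp]
    simp only [map_add, map_smul, smul_eq_mul]
  set α := φ (1, 0)
  set β := φ (0, 1)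
  have hpos : 0 < α ^ 2 + β ^ 2 := by
    by_contra! h
    have hα : α = 0 := by nlinarith [sq_nonneg α, sq_nonneg β]
    have hβ : β = 0 := by nlinarith [sq_nonneg α, sq_nonneg β]
    exact hφ (LinearMap.ext fun q => by simp [hφ' q, hα, hβ])
  have hn := Real.sq_sqrt hpos.le
  have hn0 : 0 < √(α ^ 2 + β ^ 2) := Real.sqrt_pos.mpr hpos
  set n := √(α ^ 2 + β ^ 2)
  have hle : n ≤ c := by
    have := hmax (α / n, β / n) (by
      simp only [mem_ofPred_eq, div_pow, ← add_div, hn]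
      exact (div_self hpos.ne').le)
    rw [hφ'] at this
    calc n = α / n * α + β / n * β := by field_simp; linarith
      _ ≤ c := this
  rw [hφ'] at hpc
  have hcross : p.1 * β - p.2 * α = 0 := by
    have : (p.1 * β - p.2 * α) ^ 2 = n ^ 2 - c ^ 2 := by
      rw [hn, ← hpc]
      linear_combination (α ^ 2 + β ^ 2) * hp
    nlinarith [sq_nonneg (p.1 * β - p.2 * α)]
  have hα : α = c * p.1 := by linear_combination (-α) * hp + p.1 * hpc - p.2 * hcross
  have hβ : β = c * p.2 := by linear_combination (-β) * hp + p.2 * hpc + p.1 * hcross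
  have hc0 : c ≠ 0 := by linarith
  ext q
  simp only [mem_ofPred_eq]
  rw [hφ', hα, hβ, show q.1 * (c * p.1) + q.2 * (c * p.2) = c * (q.1 * p.1 + q.2 * p.2) by ring]
  exact mul_eq_left₀ hc0

theorem isRoundBoundaryPoint_unitDisk {p : ℝ × ℝ} (hp : p.1 ^ 2 + p.2 ^ 2 = 1) :
    IsRoundBoundaryPoint {p : ℝ × ℝ | p.1 ^ 2 + p.2 ^ 2 ≤ 1} p := by
  refine ⟨mem_frontier_unitDisk hp, ?_, ?_⟩
  · rintro ⟨-, l₁, l₂, hne, h₁, h₂⟩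
    exact hne ((supportingLine_unitDisk hp h₁).trans (supportingLine_unitDisk hp h₂).symm)
  · rintro ⟨a, b, hne, hseg, s, t, hs, ht, hst, rfl⟩
    have ha := isClosed_unitDisk.frontier_subset (hseg (left_mem_segment ℝ a b))
    have hb := isClosed_unitDisk.frontier_subset (hseg (right_mem_segment ℝ a b))
    simp only [mem_ofPred_eq, Prod.fst_add, Prod.snd_add, Prod.smul_fst, Prod.smul_snd,
      smul_eq_mul] at ha hb hp
    have hd : s * t * ((a.1 - b.1) ^ 2 + (a.2 - b.2) ^ 2) ≤ 0 := by
      obtain rfl : s = 1 - t := by linarith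
      have h₁ := mul_le_mul_of_nonneg_left ha hs.le
      have h₂ := mul_le_mul_of_nonneg_left hb ht.le
      linarith
    have hd' := nonpos_of_mul_nonpos_right hd (mul_pos hs ht)
    apply hne
    ext <;> nlinarith [sq_nonneg (a.1 - b.1), sq_nonneg (a.2 - b.2)]

/-- The matrix `(1 + p.1 • σ₁ + p.2 • σ₂) / 2`. -/
noncomputable def blochMatrix (p : ℝ × ℝ) : Matrix (Fin 2) (Fin 2) ℂ :=
  !![2⁻¹, 2⁻¹ * (p.1 - p.2 * Complex.I); 2⁻¹ * (p.1 + p.2 * Complex.I), 2⁻¹]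

theorem posSemidef_blochMatrix {p : ℝ × ℝ} (hp : p.1 ^ 2 + p.2 ^ 2 ≤ 1) :
    (blochMatrix p).PosSemidef := by
  have h₁ := Matrix.posSemidef_vecMulVec_self_star (![1, p.1 + p.2 * Complex.I] : Fin 2 → ℂ)
  have h₂ : (Matrix.diagonal ![0, ((1 - (p.1 ^ 2 + p.2 ^ 2) : ℝ) : ℂ)]).PosSemidef := by
    refine Matrix.PosSemidef.diagonal fun i => ?_
    fin_cases i
    · simp
    · simpa only [Fin.mk_one, Matrix.cons_val_one, Matrix.cons_val_zero, Pi.zero_apply] using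
        Complex.zero_le_real.mpr (sub_nonneg.mpr hp)
  convert (h₁.add h₂).smul (show (0 : ℝ) ≤ 2⁻¹ by norm_num) using 1
  ext i j
  fin_cases i <;> fin_cases j <;>
    simp [blochMatrix, Matrix.vecMulVec, Complex.ext_iff, sq]
  ring_nf
  simp

/-- The pairing of indices `(i, k) ↦ 2 * i + k` identifying `ℂ² ⊗ ℂ²` with `ℂ⁴`. -/
def pairEquiv : Fin 2 × Fin 2 ≃ Fin 4 := finProdFinEquiv

/-- The partial trace over the second tensor factor of `ℂ² ⊗ ℂ²`. -/
noncomputable def partialTraceRight (ρ : Matrix (Fin 4) (Fin 4) ℂ) : Matrix (Fin 2) (Fin 2) ℂ :=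
  ∑ k, ρ.submatrix (fun i => pairEquiv (i, k)) (fun i => pairEquiv (i, k))

theorem partialTraceRight_eq (ρ : Matrix (Fin 4) (Fin 4) ℂ) : partialTraceRight ρ =
    !![ρ 0 0 + ρ 1 1, ρ 0 2 + ρ 1 3; ρ 2 0 + ρ 3 1, ρ 2 2 + ρ 3 3] := by
  ext i j
  fin_cases i <;> fin_cases j <;>
    simp [partialTraceRight, pairEquiv, finProdFinEquiv]

theorem posSemidef_partialTraceRight {ρ : Matrix (Fin 4) (Fin 4) ℂ} (hρ : ρ.PosSemidef) :
    (partialTraceRight ρ).PosSemidef :=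
  Matrix.posSemidef_sum _ fun _ _ => hρ.submatrix _

open Kronecker in
/-- The product of the left marginal of `ρ` with the Bloch matrix of `p`. -/
noncomputable def productState (ρ : Matrix (Fin 4) (Fin 4) ℂ) (p : ℝ × ℝ) :
    Matrix (Fin 4) (Fin 4) ℂ :=
  Matrix.reindex pairEquiv pairEquiv (partialTraceRight ρ ⊗ₖ blochMatrix p)

theorem posSemidef_productState {ρ : Matrix (Fin 4) (Fin 4) ℂ} (hρ : ρ.PosSemidef) {p : ℝ × ℝ}
    (hp : p.1 ^ 2 + p.2 ^ 2 ≤ 1) : (productState ρ p).PosSemidef :=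
  ((posSemidef_partialTraceRight hρ).kronecker (posSemidef_blochMatrix hp)).submatrix _

theorem productState_apply (ρ : Matrix (Fin 4) (Fin 4) ℂ) (p : ℝ × ℝ) (i j k l : Fin 2) :
    productState ρ p (pairEquiv (i, k)) (pairEquiv (j, l)) =
      partialTraceRight ρ i j * blochMatrix p k l := by
  simp [productState]

theorem productState_mem_stateSpace {ρ : Matrix (Fin 4) (Fin 4) ℂ} (hρ : ρ ∈ stateSpace 4)
    {p : ℝ × ℝ} (hp : p.1 ^ 2 + p.2 ^ 2 ≤ 1) : productState ρ p ∈ stateSpace 4 := by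
  refine ⟨posSemidef_productState hρ.1 hp, ?_⟩
  have h := hρ.2
  simp only [Matrix.trace, Matrix.diag, Fin.sum_univ_four] at h
  simp [Matrix.trace, Fin.sum_univ_four, productState, pairEquiv, finProdFinEquiv, Fin.divNat, Fin.modNat,
    partialTraceRight_eq, blochMatrix]
  linear_combination h

theorem expVal2_productState {ρ : Matrix (Fin 4) (Fin 4) ℂ} (hρ : ρ ∈ stateSpace 4)
    (p : ℝ × ℝ) : expVal2 uOne uTwo (productState ρ p) = p := by
  have h := hρ.2
  simp only [Matrix.trace, Matrix.diag, Fin.sum_univ_four, Complex.ext_iff, Complex.add_re,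
    Complex.add_im, Complex.one_re, Complex.one_im] at h
  rw [expVal2_uOne_uTwo]
  ext
  · simp [productState, pairEquiv, finProdFinEquiv, Fin.divNat, Fin.modNat, partialTraceRight_eq, blochMatrix]
    linear_combination p.1 * h.1
  · simp [productState, pairEquiv, finProdFinEquiv, Fin.divNat, Fin.modNat, partialTraceRight_eq, blochMatrix]
    linear_combination p.2 * h.1

theorem continuous_productState (ρ : Matrix (Fin 4) (Fin 4) ℂ) : Continuous (productState ρ) := by
  refine continuous_matrix fun i j => ?_
  obtain ⟨⟨i, k⟩, rfl⟩ := pairEquiv.surjective i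
  obtain ⟨⟨j, l⟩, rfl⟩ := pairEquiv.surjective j
  simp only [productState_apply]
  fin_cases k <;> fin_cases l <;> simp [blochMatrix] <;> fun_prop

theorem mulVec_single_sub_smul_single {n : Type*} [Fintype n] [DecidableEq n]
    (ρ : Matrix n n ℂ) (k l : n) (c : ℂ) (j : n) :
    (ρ *ᵥ (Pi.single k 1 - c • Pi.single l 1)) j = ρ j k - c * ρ j l := by
  simp [Matrix.mulVec_sub, Matrix.mulVec_smul]

theorem quadForm_single_sub_smul_single {n : Type*} [Fintype n] [DecidableEq n]
    (ρ : Matrix n n ℂ) (k l : n) (c : ℂ) :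
    star (Pi.single k 1 - c • Pi.single l 1) ⬝ᵥ (ρ *ᵥ (Pi.single k 1 - c • Pi.single l 1)) =
      ρ k k - c * ρ k l - star c * (ρ l k - c * ρ l l) := by
  simp [sub_dotProduct, mulVec_single_sub_smul_single]

theorem expVal2_of_isHermitian {ρ : Matrix (Fin 4) (Fin 4) ℂ} (hρ : ρ.IsHermitian) :
    expVal2 uOne uTwo ρ = (2 * ((ρ 0 1).re + (ρ 2 3).re), -2 * ((ρ 0 1).im + (ρ 2 3).im)) := by
  rw [expVal2_uOne_uTwo, ← hρ.apply 1 0, ← hρ.apply 3 2]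
  ext <;> simp <;> ring

theorem isHermitian_apply_self_im {n : Type*} {ρ : Matrix n n ℂ} (hρ : ρ.IsHermitian) (k : n) :
    (ρ k k).im = 0 :=
  Complex.conj_eq_iff_im.mp (hρ.apply k k)

/-- The sum of the quadratic form of a hermitian matrix at `(1, -tω, 0, 0)` and `(0, 0, 1, -tω)`,
where `ω` is the expected value of the matrix read as a complex number. -/
theorem quadForm_add_quadForm_re {ρ : Matrix (Fin 4) (Fin 4) ℂ} (hρ : ρ.IsHermitian) (t : ℝ) :
    (ρ 0 0 - (t * ((expVal2 uOne uTwo ρ).1 + (expVal2 uOne uTwo ρ).2 * Complex.I)) * ρ 0 1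
      - star (t * ((expVal2 uOne uTwo ρ).1 + (expVal2 uOne uTwo ρ).2 * Complex.I) : ℂ) *
        (ρ 1 0 - (t * ((expVal2 uOne uTwo ρ).1 + (expVal2 uOne uTwo ρ).2 * Complex.I)) * ρ 1 1)).re
    + (ρ 2 2 - (t * ((expVal2 uOne uTwo ρ).1 + (expVal2 uOne uTwo ρ).2 * Complex.I)) * ρ 2 3
      - star (t * ((expVal2 uOne uTwo ρ).1 + (expVal2 uOne uTwo ρ).2 * Complex.I) : ℂ) *
        (ρ 3 2 - (t * ((expVal2 uOne uTwo ρ).1 + (expVal2 uOne uTwo ρ).2 * Complex.I)) * ρ 3 3)).re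
    = ((expVal2 uOne uTwo ρ).1 ^ 2 + (expVal2 uOne uTwo ρ).2 ^ 2) *
          ((ρ 1 1).re + (ρ 3 3).re) * (t * t)
        + -((expVal2 uOne uTwo ρ).1 ^ 2 + (expVal2 uOne uTwo ρ).2 ^ 2) * t
        + ((ρ 0 0).re + (ρ 2 2).re) := by
  rw [expVal2_of_isHermitian hρ, ← hρ.apply 1 0, ← hρ.apply 3 2]
  simp [isHermitian_apply_self_im hρ]
  ring

theorem expVal2_mem_unitDisk {ρ : Matrix (Fin 4) (Fin 4) ℂ} (hρ : ρ ∈ stateSpace 4) :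
    (expVal2 uOne uTwo ρ).1 ^ 2 + (expVal2 uOne uTwo ρ).2 ^ 2 ≤ 1 := by
  have htr := congrArg Complex.re hρ.2
  simp only [Matrix.trace, Matrix.diag, Fin.sum_univ_four, Complex.add_re, Complex.one_re] at htr
  have hd := discrim_le_zero fun t : ℝ => by
    rw [← quadForm_add_quadForm_re hρ.1.isHermitian t, ← quadForm_single_sub_smul_single,
      ← quadForm_single_sub_smul_single]
    exact add_nonneg (hρ.1.re_dotProduct_nonneg _) (hρ.1.re_dotProduct_nonneg _)
  rw [discrim] at hd
  set r := (expVal2 uOne uTwo ρ).1 ^ 2 + (expVal2 uOne uTwo ρ).2 ^ 2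
  set A := (ρ 0 0).re + (ρ 2 2).re
  set B := (ρ 1 1).re + (ρ 3 3).re
  have hAB : 4 * (A * B) ≤ 1 := by
    nlinarith [sq_nonneg (A - B), show A + B = 1 by linarith]
  by_contra! hr
  nlinarith

theorem apply_eq_mul_of_mem_circle {ρ : Matrix (Fin 4) (Fin 4) ℂ} (hρ : ρ ∈ stateSpace 4)
    (h : (expVal2 uOne uTwo ρ).1 ^ 2 + (expVal2 uOne uTwo ρ).2 ^ 2 = 1) (a : Fin 4) (i : Fin 2) :
    ρ a (pairEquiv (i, 0)) =
      ((expVal2 uOne uTwo ρ).1 + (expVal2 uOne uTwo ρ).2 * Complex.I) *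
        ρ a (pairEquiv (i, 1)) := by
  have htr := congrArg Complex.re hρ.2
  simp only [Matrix.trace, Matrix.diag, Fin.sum_univ_four, Complex.add_re, Complex.one_re] at htr
  have hq := quadForm_add_quadForm_re hρ.1.isHermitian 1
  rw [h, Complex.ofReal_one, one_mul, ← quadForm_single_sub_smul_single,
    ← quadForm_single_sub_smul_single] at hq
  set ω : ℂ := (expVal2 uOne uTwo ρ).1 + (expVal2 uOne uTwo ρ).2 * Complex.I
  have hker (k l : Fin 4) (hkl : (star (Pi.single k 1 - ω • Pi.single l 1) ⬝ᵥ
      (ρ *ᵥ (Pi.single k 1 - ω • Pi.single l 1))).re = 0) : ρ a k = ω * ρ a l := by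
    rw [← sub_eq_zero, ← mulVec_single_sub_smul_single,
      (hρ.1.dotProduct_mulVec_zero_iff _).mp, Pi.zero_apply]
    exact Complex.ext hkl (Complex.nonneg_iff.mp (hρ.1.dotProduct_mulVec_nonneg _)).2.symm
  have h₀ := hρ.1.re_dotProduct_nonneg (Pi.single 0 1 - ω • Pi.single 1 1)
  have h₁ := hρ.1.re_dotProduct_nonneg (Pi.single 2 1 - ω • Pi.single 3 1)
  rw [RCLike.re_eq_complex_re] at h₀ h₁
  fin_cases i
  · exact hker 0 1 (by linarith)
  · exact hker 2 3 (by linarith)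

theorem productState_of_mem_circle {ρ : Matrix (Fin 4) (Fin 4) ℂ} (hρ : ρ ∈ stateSpace 4)
    (h : (expVal2 uOne uTwo ρ).1 ^ 2 + (expVal2 uOne uTwo ρ).2 ^ 2 = 1) :
    productState ρ (expVal2 uOne uTwo ρ) = ρ := by
  have hcol := apply_eq_mul_of_mem_circle hρ h
  set p := expVal2 uOne uTwo ρ
  have hrow (i : Fin 2) (b : Fin 4) : ρ (pairEquiv (i, 0)) b =
      (p.1 - p.2 * Complex.I) * ρ (pairEquiv (i, 1)) b := by
    rw [← hρ.1.isHermitian.apply, hcol, star_mul', hρ.1.isHermitian.apply]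
    simp [sub_eq_add_neg]
  have hω : ((p.1 : ℂ) + p.2 * Complex.I) * (p.1 - p.2 * Complex.I) = 1 := by
    have : (p.1 : ℂ) ^ 2 + (p.2 : ℂ) ^ 2 = 1 := by exact_mod_cast h
    linear_combination this - (p.2 : ℂ) ^ 2 * Complex.I_sq
  ext a b
  obtain ⟨⟨i, k⟩, rfl⟩ := pairEquiv.surjective a
  obtain ⟨⟨j, l⟩, rfl⟩ := pairEquiv.surjective b
  have h₀₀ := hcol (pairEquiv (i, 0)) j
  have h₀₁ := hrow i (pairEquiv (j, 1))
  have h₁₀ := hcol (pairEquiv (i, 1)) j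
  rw [productState_apply]
  simp only [partialTraceRight, Fin.sum_univ_two, Matrix.add_apply, Matrix.submatrix_apply]
  set x := ρ (pairEquiv (i, 1)) (pairEquiv (j, 1))
  rw [h₀₀, h₀₁]
  fin_cases k <;> fin_cases l <;> simp [blochMatrix, h₀₀, h₀₁, h₁₀]
  · linear_combination (-x / 2) * hω
  · linear_combination (x * (p.1 - p.2 * Complex.I) / 2) * hω
  · linear_combination (x * (p.1 + p.2 * Complex.I) / 2) * hω
  · linear_combination (x / 2) * hω

theorem expVal2_add_smul {d : ℕ} (u₁ u₂ ρ τ : Matrix (Fin d) (Fin d) ℂ) (a b : ℝ) :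
    expVal2 u₁ u₂ (a • ρ + b • τ) = a • expVal2 u₁ u₂ ρ + b • expVal2 u₁ u₂ τ := by
  simp [expVal2, Matrix.mul_add]

theorem convex_stateSpace (d : ℕ) : Convex ℝ (stateSpace d) := by
  intro ρ hρ τ hτ a b ha hb hab
  refine ⟨(hρ.1.smul ha).add (hτ.1.smul hb), ?_⟩
  simp [Matrix.trace_add, Matrix.trace_smul, hρ.2, hτ.2, ← Complex.ofReal_add, hab]

theorem mapsOpenAt_expVal2 {ρ : Matrix (Fin 4) (Fin 4) ℂ} (hρ : ρ ∈ stateSpace 4) :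
    MapsOpenAt (expVal2 uOne uTwo) (stateSpace 4) {p : ℝ × ℝ | p.1 ^ 2 + p.2 ^ 2 ≤ 1} ρ := by
  intro N hN hNρ
  set w := expVal2 uOne uTwo ρ with hw
  rcases (expVal2_mem_unitDisk hρ).lt_or_eq with hlt | heq
  · obtain ⟨U, hU, hρU, hUN⟩ := mem_nhdsWithin.mp hNρ
    have hpath : Tendsto (fun ε : ℝ => (1 - ε) • ρ + ε • productState ρ w) (𝓝[>] 0) (𝓝 ρ) := by
      have : Continuous fun ε : ℝ => (1 - ε) • ρ + ε • productState ρ w := by fun_prop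
      simpa using (this.tendsto 0).mono_left nhdsWithin_le_nhds
    obtain ⟨ε, ⟨hεU, hε1⟩, hε0⟩ := ((hpath.eventually_mem (hU.mem_nhds hρU)).and
      (nhdsWithin_le_nhds (Iio_mem_nhds one_pos)) |>.and self_mem_nhdsWithin).exists
    replace hε0 : 0 < ε := hε0
    have hcont : Continuous fun z => w + ε⁻¹ • (z - w) := by fun_prop
    have hcw : w + ε⁻¹ • (w - w) = w := by simp
    have hdisk : ∀ᶠ z in 𝓝 w, w + ε⁻¹ • (z - w) ∈ {p : ℝ × ℝ | p.1 ^ 2 + p.2 ^ 2 < 1} := by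
      refine hcont.continuousAt.eventually_mem ((isOpen_lt (by fun_prop) (by fun_prop)).mem_nhds ?_)
      rwa [hcw]
    have hmem : ∀ᶠ z in 𝓝 w,
        (1 - ε) • ρ + ε • productState ρ (w + ε⁻¹ • (z - w)) ∈ U := by
      have hg : Continuous fun z => (1 - ε) • ρ + ε • productState ρ (w + ε⁻¹ • (z - w)) :=
        continuous_const.add (((continuous_productState ρ).comp hcont).const_smul ε)
      refine hg.continuousAt.eventually_mem (hU.mem_nhds ?_)
      rwa [hcw]
    filter_upwards [nhdsWithin_le_nhds hdisk, nhdsWithin_le_nhds hmem] with z hz hzU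
    refine ⟨_, hUN ⟨hzU, convex_stateSpace 4 hρ
      (productState_mem_stateSpace hρ (le_of_lt hz)) (sub_nonneg.mpr (le_of_lt hε1)) hε0.le
      (sub_add_cancel 1 ε)⟩, ?_⟩
    rw [expVal2_add_smul, expVal2_productState hρ, ← hw, smul_add, smul_inv_smul₀ hε0.ne',
      sub_smul, one_smul]
    abel
  · have hs : Tendsto (productState ρ) (𝓝[{p : ℝ × ℝ | p.1 ^ 2 + p.2 ^ 2 ≤ 1}] w)
        (𝓝[stateSpace 4] ρ) := by
      refine tendsto_nhdsWithin_iff.mpr ⟨?_, ?_⟩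
      · have := (continuous_productState ρ).tendsto w
        rw [hw, productState_of_mem_circle hρ heq] at this
        exact this.mono_left nhdsWithin_le_nhds
      · filter_upwards [self_mem_nhdsWithin] with p hp
        exact productState_mem_stateSpace hρ hp
    filter_upwards [hs hNρ] with p hp
    exact ⟨_, hp, expVal2_productState hρ p⟩

open Kronecker in
theorem open_at_every_state_of_doubled_ellipse :
    (uOne + Complex.I • uTwo =
      Matrix.reindex finProdFinEquiv finProdFinEquiv
        ((1 : Matrix (Fin 2) (Fin 2) ℂ) ⊗ₖ !![0, 2; 0, 0])) ∧
    (jointNR uOne uTwo = {p : ℝ × ℝ | p.1 ^ 2 + p.2 ^ 2 ≤ 1}) ∧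
    (∀ p : ℝ × ℝ, p.1 ^ 2 + p.2 ^ 2 = 1 →
      MultiplyGenerated uOne uTwo p ∧ IsRoundBoundaryPoint (jointNR uOne uTwo) p) ∧
    (∀ ρ ∈ stateSpace 4, MapsOpenAt (expVal2 uOne uTwo) (stateSpace 4) (jointNR uOne uTwo) ρ) := by
  refine ⟨?_, jointNR_uOne_uTwo, fun p hp => ⟨multiplyGenerated_of_mem_circle hp, ?_⟩,
    fun ρ hρ => ?_⟩
  · ext i j
    fin_cases i <;> fin_cases j <;>
      simp [uOne_eq, uTwo_eq, finProdFinEquiv, Fin.divNat, Fin.modNat] <;>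
      norm_num
  · rw [jointNR_uOne_uTwo]
    exact isRoundBoundaryPoint_unitDisk hp
  · rw [jointNR_uOne_uTwo]
    exact mapsOpenAt_expVal2 hρ
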